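/- arXiv:2207.06212 — 3 statements merged into one kernel-verified Lean document; each statement's English description precedes it below -/
import Mathlib

section
/- For every positive integer n and every subset S̄ = {s_1 < s_2 < ··· < s_k} ⊆ {1,...,n−1}, the number α̂_n^-(S̄) of type B permutations σ of order n with σ(1) < 0 whose set of type B alternating descent positions is contained in S̄ equals the multinomial coefficient n!/(s_1!(s_2−s_1)!···(n−s_k)!) times S_{s_1} · DU^{(B)}_{s_2−s_1} · DU^{(B)}_{s_3−s_2} ··· DU^{(B)}_{n−s_k}, where S_m is the number of snakes of length m and DU^{(B)}_m is the number of down-up alternating type B permutations of length m. -/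
open Finset

/-- The word of a permutation of `{1,...,n}` with boundary convention `σ(0) = σ(n+1) = n+1`. -/
def extA (n : ℕ) (σ : Equiv.Perm (Fin n)) : ℕ → ℕ := fun i =>
  if h : 1 ≤ i ∧ i ≤ n then (σ ⟨i - 1, by omega⟩ : ℕ) + 1 else n + 1

/-- The word of a permutation of `{1,...,n}` with boundary convention `σ(0) = 0`, `σ(n+1) = n+1`. -/
def ext0 (n : ℕ) (σ : Equiv.Perm (Fin n)) : ℕ → ℕ := fun i =>
  if h : 1 ≤ i ∧ i ≤ n then (σ ⟨i - 1, by omega⟩ : ℕ) + 1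
  else if i = 0 then 0 else n + 1

/-- Number of double ascents (indices `i ∈ {1,...,n}` with `w(i-1) < w(i) < w(i+1)`). -/
def daCount (n : ℕ) (w : ℕ → ℕ) : ℕ :=
  ((Icc 1 n).filter fun i => w (i - 1) < w i ∧ w i < w (i + 1)).card

/-- Number of double descents (indices `i ∈ {1,...,n}` with `w(i-1) > w(i) > w(i+1)`). -/
def ddCount (n : ℕ) (w : ℕ → ℕ) : ℕ :=
  ((Icc 1 n).filter fun i => w i < w (i - 1) ∧ w (i + 1) < w i).card

/-- Number of valleys (indices `i ∈ {1,...,n}` with `w(i-1) > w(i) < w(i+1)`). -/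
def valCount (n : ℕ) (w : ℕ → ℕ) : ℕ :=
  ((Icc 1 n).filter fun i => w i < w (i - 1) ∧ w i < w (i + 1)).card

/-- Number of peaks (indices `i ∈ {1,...,n}` with `w(i-1) < w(i) > w(i+1)`). -/
def pkCount (n : ℕ) (w : ℕ → ℕ) : ℕ :=
  ((Icc 1 n).filter fun i => w (i - 1) < w i ∧ w (i + 1) < w i).card

/-- `dda = da + dd`. -/
def ddaCount (n : ℕ) (w : ℕ → ℕ) : ℕ := daCount n w + ddCount n w

/-- Number of alternating descents of a permutation of `{1,...,n}`:
indices `i ∈ {1,...,n-1}` with `σ(i) > σ(i+1)` and `i` odd, or `σ(i) < σ(i+1)` and `i` even. -/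
def altDesA (n : ℕ) (σ : Equiv.Perm (Fin n)) : ℕ :=
  ((Ico 1 n).filter fun i =>
    (Odd i ∧ extA n σ (i + 1) < extA n σ i) ∨ (Even i ∧ extA n σ i < extA n σ (i + 1))).card

/-- The alternating Eulerian polynomial `Â_n(x)`. -/
noncomputable def hatA (n : ℕ) (x : ℝ) : ℝ := ∑ σ : Equiv.Perm (Fin n), x ^ altDesA n σ

/-- The signed word of a type B permutation encoded as a pair `(σ, ε)` of a permutation of
`{1,...,n}` and a sign vector; position `0` (and positions `> n`) carry the value `0`. -/
def wordB (n : ℕ) (σ : Equiv.Perm (Fin n)) (ε : Fin n → Bool) : ℕ → ℤ := fun i =>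
  if h : 1 ≤ i ∧ i ≤ n then
    (if ε ⟨i - 1, by omega⟩ then ((σ ⟨i - 1, by omega⟩ : ℕ) + 1 : ℤ)
     else -((σ ⟨i - 1, by omega⟩ : ℕ) + 1 : ℤ))
  else 0

/-- `i` is an alternating descent position of the word `w`:
either `i` is even and `w(i) < w(i+1)`, or `i` is odd and `w(i) > w(i+1)`. -/
def isAltDesZ (w : ℕ → ℤ) (i : ℕ) : Prop :=
  (Even i ∧ w i < w (i + 1)) ∨ (Odd i ∧ w (i + 1) < w i)

instance (w : ℕ → ℤ) : DecidablePred (isAltDesZ w) := fun i => by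
  unfold isAltDesZ; infer_instance

/-- `d̂_B`: number of type B alternating descent positions `i ∈ {0,1,...,n-1}`. -/
def altDesB (n : ℕ) (σ : Equiv.Perm (Fin n)) (ε : Fin n → Bool) : ℕ :=
  ((range n).filter (isAltDesZ (wordB n σ ε))).card

/-- The type B alternating Eulerian polynomial `B̂_n(x)`. -/
noncomputable def hatB (n : ℕ) (x : ℝ) : ℝ :=
  ∑ p : Equiv.Perm (Fin n) × (Fin n → Bool), x ^ altDesB n p.1 p.2

/-- `d̂`: number of alternating descent positions `i ∈ {1,...,n-1}` of a signed word
(position `0` excluded). -/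
def altDesWord (n : ℕ) (w : ℕ → ℤ) : ℕ := ((Ico 1 n).filter (isAltDesZ w)).card

/-- Derivative polynomials of the tangent function: `P₀ = X`, `P_{n+1} = (1+X²)·Pₙ'`. -/
noncomputable def tanP : ℕ → Polynomial ℝ
  | 0 => Polynomial.X
  | n + 1 => (1 + Polynomial.X ^ 2) * Polynomial.derivative (tanP n)

/-- Derivative polynomials of the secant function: `Q₀ = 1`, `Q_{n+1} = X·Qₙ + (1+X²)·Qₙ'`. -/
noncomputable def secQ : ℕ → Polynomial ℝ
  | 0 => 1
  | n + 1 => Polynomial.X * secQ n + (1 + Polynomial.X ^ 2) * Polynomial.derivative (secQ n)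

/-- The word of `(σ, ε)` is down-up alternating: `π(1) > π(2) < π(3) > π(4) ⋯`. -/
def isDownUpB (m : ℕ) (σ : Equiv.Perm (Fin m)) (ε : Fin m → Bool) : Prop :=
  ∀ i ∈ Ico 1 m,
    (Odd i → wordB m σ ε (i + 1) < wordB m σ ε i) ∧
    (Even i → wordB m σ ε i < wordB m σ ε (i + 1))

instance (m : ℕ) (σ : Equiv.Perm (Fin m)) (ε : Fin m → Bool) : Decidable (isDownUpB m σ ε) := by
  unfold isDownUpB; infer_instance

/-- `DU_m^{(B)}`: the number of down-up alternating type B permutations of length `m`. -/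
def duBCount (m : ℕ) : ℕ :=
  (Finset.univ.filter fun p : Equiv.Perm (Fin m) × (Fin m → Bool) =>
    isDownUpB m p.1 p.2).card

/-- `S_m`: the number of snakes of length `m` (down-up alternating type B permutations
whose first entry is positive). -/
def snakeCount (m : ℕ) : ℕ :=
  (Finset.univ.filter fun p : Equiv.Perm (Fin m) × (Fin m → Bool) =>
    0 < wordB m p.1 p.2 1 ∧ isDownUpB m p.1 p.2).card

/-- `B̂_n^-(x)`: sum over type B permutations with negative first entry. -/
noncomputable def hatBminus (n : ℕ) (x : ℝ) : ℝ :=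
  ∑ p ∈ Finset.univ.filter
      (fun p : Equiv.Perm (Fin n) × (Fin n → Bool) => wordB n p.1 p.2 1 < 0),
    x ^ altDesB n p.1 p.2

/-- `B̂_n^+(x)`: sum over type B permutations with positive first entry. -/
noncomputable def hatBplus (n : ℕ) (x : ℝ) : ℝ :=
  ∑ p ∈ Finset.univ.filter
      (fun p : Equiv.Perm (Fin n) × (Fin n → Bool) => 0 < wordB n p.1 p.2 1),
    x ^ altDesB n p.1 p.2

/-- The boundary sequence `0 = t₀ < s₁ < s₂ < ⋯ < s_k < t_{k+1} = n` associated to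
`S̄ = {s₁ < ⋯ < s_k} ⊆ {1,...,n-1}`. -/
def bndFun (n k : ℕ) (s : Fin k → ℕ) : ℕ → ℕ := fun j =>
  if h : 1 ≤ j ∧ j ≤ k then s ⟨j - 1, by omega⟩ else if j = 0 then 0 else n

/-- The parts `(s₁, s₂ - s₁, ..., n - s_k)` of the composition `co(S̄)` of `n`. -/
def compParts (n k : ℕ) (s : Fin k → ℕ) : Fin (k + 1) → ℕ := fun j =>
  bndFun n k s ((j : ℕ) + 1) - bndFun n k s (j : ℕ)

/-- The integer with absolute value `x + 1` and sign `e`, where `true` stands for `+`. -/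
def signedVal (e : Bool) (x : ℕ) : ℤ := if e then (x + 1 : ℤ) else -(x + 1 : ℤ)

theorem signedVal_lt_zero_iff {e : Bool} {x : ℕ} : signedVal e x < 0 ↔ e = false := by
  cases e <;> simp [signedVal] <;> omega

theorem signedVal_lt_signedVal_iff {m n : ℕ} {f : Fin m → Fin n} (hf : StrictMono f)
    {e e' : Bool} {x y : Fin m} :
    signedVal e (f x) < signedVal e' (f y) ↔ signedVal e x < signedVal e' y := by
  have hlt : ((f x : ℕ) < f y) ↔ (x : ℕ) < y := hf.lt_iff_lt
  have hgt : ((f y : ℕ) < f x) ↔ (y : ℕ) < x := hf.lt_iff_lt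
  cases e <;> cases e' <;> simp [signedVal] <;> omega

theorem wordB_add_one {n : ℕ} (σ : Equiv.Perm (Fin n)) (ε : Fin n → Bool) (i : Fin n) :
    wordB n σ ε (i + 1) = signedVal (ε i) (σ i) := by
  have := i.isLt
  simp [wordB, signedVal]

theorem wordB_not {n : ℕ} (σ : Equiv.Perm (Fin n)) (ε : Fin n → Bool) (i : ℕ) :
    wordB n σ (fun j => !ε j) i = -wordB n σ ε i := by
  unfold wordB
  split_ifs <;> simp_all

theorem wordB_ne_succ {n : ℕ} (σ : Equiv.Perm (Fin n)) (ε : Fin n → Bool) {i : ℕ}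
    (hi : i ∈ Ico 1 n) : wordB n σ ε i ≠ wordB n σ ε (i + 1) := by
  rw [mem_Ico] at hi
  obtain ⟨i, rfl⟩ := Nat.exists_eq_add_of_le' hi.1
  have h₁ := wordB_add_one σ ε ⟨i, by omega⟩
  have h₂ := wordB_add_one σ ε ⟨i + 1, by omega⟩
  simp only at h₁ h₂
  rw [h₁, h₂]
  have hne : (σ ⟨i, by omega⟩ : ℕ) ≠ σ ⟨i + 1, by omega⟩ := by
    simp [Fin.val_inj]
  unfold signedVal
  split_ifs <;> omega

/-- Negating every entry, as an involution on encoded type B permutations. -/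
def negSigns (n : ℕ) :
    Equiv.Perm (Fin n) × (Fin n → Bool) ≃ Equiv.Perm (Fin n) × (Fin n → Bool) :=
  (Equiv.refl _).prodCongr (Equiv.arrowCongr (Equiv.refl _) Equiv.boolNot)

theorem wordB_negSigns {n : ℕ} (p : Equiv.Perm (Fin n) × (Fin n → Bool)) (i : ℕ) :
    wordB n (negSigns n p).1 (negSigns n p).2 i = -wordB n p.1 p.2 i :=
  wordB_not p.1 p.2 i

theorem card_filter_negSigns {n : ℕ} (P : Equiv.Perm (Fin n) × (Fin n → Bool) → Prop)
    [DecidablePred P] [DecidablePred fun p => P (negSigns n p)] :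
    (univ.filter fun p => P (negSigns n p)).card = (univ.filter P).card :=
  card_equiv (negSigns n) (by simp)

section Merge

variable {a b : ℕ}

theorem card_compl_eq_of_card_eq {A : Finset (Fin (a + b))} (hA : A.card = a) : Aᶜ.card = b := by
  rw [card_compl, hA, Fintype.card_fin, Nat.add_sub_cancel_left]

/-- The permutation whose first `a` values form the set `A`, in the relative order given by `τ₁`,
and whose last `b` values are in the relative order given by `τ₂`. -/
def mergePerm (A : {A : Finset (Fin (a + b)) // A.card = a}) (τ₁ : Equiv.Perm (Fin a))
    (τ₂ : Equiv.Perm (Fin b)) : Equiv.Perm (Fin (a + b)) :=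
  finSumFinEquiv.symm.trans
    ((τ₁.sumCongr τ₂).trans (finSumEquivOfFinset A.2 (card_compl_eq_of_card_eq A.2)))

theorem mergePerm_castAdd (A : {A : Finset (Fin (a + b)) // A.card = a})
    (τ₁ : Equiv.Perm (Fin a)) (τ₂ : Equiv.Perm (Fin b)) (i : Fin a) :
    mergePerm A τ₁ τ₂ (Fin.castAdd b i) = A.1.orderEmbOfFin A.2 (τ₁ i) := by
  simp [mergePerm]

theorem mergePerm_natAdd (A : {A : Finset (Fin (a + b)) // A.card = a})
    (τ₁ : Equiv.Perm (Fin a)) (τ₂ : Equiv.Perm (Fin b)) (i : Fin b) :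
    mergePerm A τ₁ τ₂ (Fin.natAdd a i) =
      (A.1ᶜ).orderEmbOfFin (card_compl_eq_of_card_eq A.2) (τ₂ i) := by
  simp [mergePerm]

theorem coe_eq_range_mergePerm (A : {A : Finset (Fin (a + b)) // A.card = a})
    (τ₁ : Equiv.Perm (Fin a)) (τ₂ : Equiv.Perm (Fin b)) :
    (A.1 : Set (Fin (a + b))) = Set.range fun i => mergePerm A τ₁ τ₂ (Fin.castAdd b i) := by
  simp_rw [mergePerm_castAdd]
  rw [← Finset.range_orderEmbOfFin A.1 A.2]
  exact (τ₁.surjective.range_comp _).symm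

theorem mergePerm_injective : Function.Injective
    fun x : {A : Finset (Fin (a + b)) // A.card = a} × Equiv.Perm (Fin a) × Equiv.Perm (Fin b) =>
      mergePerm x.1 x.2.1 x.2.2 := by
  rintro ⟨A, τ₁, τ₂⟩ ⟨A', τ₁', τ₂'⟩ h
  simp only at h
  obtain rfl : A = A' := by
    apply Subtype.ext
    rw [← coe_inj, coe_eq_range_mergePerm A τ₁ τ₂, h, ← coe_eq_range_mergePerm]
  have h₁ : τ₁ = τ₁' := Equiv.ext fun i => by
    simpa [mergePerm_castAdd] using DFunLike.congr_fun h (Fin.castAdd b i)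
  have h₂ : τ₂ = τ₂' := Equiv.ext fun i => by
    simpa [mergePerm_natAdd] using DFunLike.congr_fun h (Fin.natAdd a i)
  rw [h₁, h₂]

theorem mergePerm_bijective : Function.Bijective
    fun x : {A : Finset (Fin (a + b)) // A.card = a} × Equiv.Perm (Fin a) × Equiv.Perm (Fin b) =>
      mergePerm x.1 x.2.1 x.2.2 := by
  refine (Fintype.bijective_iff_injective_and_card _).2 ⟨mergePerm_injective, ?_⟩
  simp only [Fintype.card_prod, Fintype.card_finset_len, Fintype.card_perm, Fintype.card_fin]
  rw [← Nat.add_choose_mul_factorial_mul_factorial a b, Nat.choose_symm_add, mul_assoc]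

/-- Concatenation of two type B permutations after relabelling the absolute values of the first one
by `A` and those of the second one by the complement of `A`. -/
def mergeB (A : {A : Finset (Fin (a + b)) // A.card = a})
    (x : Equiv.Perm (Fin a) × (Fin a → Bool)) (y : Equiv.Perm (Fin b) × (Fin b → Bool)) :
    Equiv.Perm (Fin (a + b)) × (Fin (a + b) → Bool) :=
  (mergePerm A x.1 y.1, Fin.append x.2 y.2)

theorem mergeB_bijective : Function.Bijective
    fun x : {A : Finset (Fin (a + b)) // A.card = a} ×
        (Equiv.Perm (Fin a) × (Fin a → Bool)) × (Equiv.Perm (Fin b) × (Fin b → Bool)) =>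
      mergeB x.1 x.2.1 x.2.2 := by
  constructor
  · rintro ⟨A, ⟨τ₁, ε₁⟩, τ₂, ε₂⟩ ⟨A', ⟨τ₁', ε₁'⟩, τ₂', ε₂'⟩ h
    obtain ⟨h, hε⟩ := Prod.mk.inj h
    have h := @mergePerm_injective a b (A, τ₁, τ₂) (A', τ₁', τ₂') h
    have hε := (Fin.appendEquiv a b).injective (a₁ := (ε₁, ε₂)) (a₂ := (ε₁', ε₂')) hε
    simp_all
  · rintro ⟨σ, ε⟩
    obtain ⟨⟨A, τ₁, τ₂⟩, rfl⟩ := mergePerm_bijective.2 σ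
    obtain ⟨⟨ε₁, ε₂⟩, rfl⟩ := (Fin.appendEquiv a b).surjective ε
    exact ⟨⟨A, ⟨τ₁, ε₁⟩, τ₂, ε₂⟩, rfl⟩

theorem card_filter_of_mergeB_iff (R : Equiv.Perm (Fin (a + b)) × (Fin (a + b) → Bool) → Prop)
    (P : Equiv.Perm (Fin a) × (Fin a → Bool) → Prop)
    (Q : Equiv.Perm (Fin b) × (Fin b → Bool) → Prop)
    [DecidablePred R] [DecidablePred P] [DecidablePred Q]
    (h : ∀ A x y, R (mergeB A x y) ↔ P x ∧ Q y) :
    (univ.filter R).card = (a + b).choose a * ((univ.filter P).card * (univ.filter Q).card) := by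
  have hA : (a + b).choose a =
      (univ : Finset {A : Finset (Fin (a + b)) // A.card = a}).card := by
    rw [card_univ, Fintype.card_finset_len, Fintype.card_fin]
  rw [hA, ← card_product, ← card_product]
  symm
  refine card_equiv (Equiv.ofBijective _ mergeB_bijective) ?_
  rintro ⟨A, x, y⟩
  simp [h]

theorem wordB_mergeB_left (A : {A : Finset (Fin (a + b)) // A.card = a})
    (x : Equiv.Perm (Fin a) × (Fin a → Bool)) (y : Equiv.Perm (Fin b) × (Fin b → Bool))
    (i : Fin a) :
    wordB (a + b) (mergeB A x y).1 (mergeB A x y).2 (i + 1) =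
      signedVal (x.2 i) (A.1.orderEmbOfFin A.2 (x.1 i)) := by
  have h := wordB_add_one (mergeB A x y).1 (mergeB A x y).2 (Fin.castAdd b i)
  simp only [Fin.val_castAdd] at h
  rw [h]
  simp only [mergeB, Fin.append_left, mergePerm_castAdd]

theorem wordB_mergeB_right (A : {A : Finset (Fin (a + b)) // A.card = a})
    (x : Equiv.Perm (Fin a) × (Fin a → Bool)) (y : Equiv.Perm (Fin b) × (Fin b → Bool))
    (i : Fin b) :
    wordB (a + b) (mergeB A x y).1 (mergeB A x y).2 (a + (i + 1)) =
      signedVal (y.2 i) ((A.1ᶜ).orderEmbOfFin (card_compl_eq_of_card_eq A.2) (y.1 i)) := by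
  have h := wordB_add_one (mergeB A x y).1 (mergeB A x y).2 (Fin.natAdd a i)
  simp only [Fin.val_natAdd] at h
  rw [← add_assoc, h]
  simp only [mergeB, Fin.append_right, mergePerm_natAdd]

theorem wordB_mergeB_one_neg_iff (ha : 0 < a) (A : {A : Finset (Fin (a + b)) // A.card = a})
    (x : Equiv.Perm (Fin a) × (Fin a → Bool)) (y : Equiv.Perm (Fin b) × (Fin b → Bool)) :
    wordB (a + b) (mergeB A x y).1 (mergeB A x y).2 1 < 0 ↔ wordB a x.1 x.2 1 < 0 := by
  have h := wordB_mergeB_left A x y ⟨0, ha⟩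
  have h' := wordB_add_one x.1 x.2 ⟨0, ha⟩
  simp only [zero_add] at h h'
  rw [h, h', signedVal_lt_zero_iff, signedVal_lt_zero_iff]

theorem wordB_mergeB_lt_iff_left (A : {A : Finset (Fin (a + b)) // A.card = a})
    (x : Equiv.Perm (Fin a) × (Fin a → Bool)) (y : Equiv.Perm (Fin b) × (Fin b → Bool))
    {i j : ℕ} (hi : i ∈ Icc 1 a) (hj : j ∈ Icc 1 a) :
    wordB (a + b) (mergeB A x y).1 (mergeB A x y).2 i <
        wordB (a + b) (mergeB A x y).1 (mergeB A x y).2 j ↔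
      wordB a x.1 x.2 i < wordB a x.1 x.2 j := by
  rw [mem_Icc] at hi hj
  obtain ⟨i, rfl⟩ := Nat.exists_eq_add_of_le' hi.1
  obtain ⟨j, rfl⟩ := Nat.exists_eq_add_of_le' hj.1
  rw [wordB_mergeB_left A x y ⟨i, hi.2⟩, wordB_mergeB_left A x y ⟨j, hj.2⟩,
    wordB_add_one x.1 x.2 ⟨i, hi.2⟩, wordB_add_one x.1 x.2 ⟨j, hj.2⟩,
    signedVal_lt_signedVal_iff (OrderEmbedding.strictMono _)]

theorem wordB_mergeB_lt_iff_right (A : {A : Finset (Fin (a + b)) // A.card = a})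
    (x : Equiv.Perm (Fin a) × (Fin a → Bool)) (y : Equiv.Perm (Fin b) × (Fin b → Bool))
    {i j : ℕ} (hi : i ∈ Icc 1 b) (hj : j ∈ Icc 1 b) :
    wordB (a + b) (mergeB A x y).1 (mergeB A x y).2 (a + i) <
        wordB (a + b) (mergeB A x y).1 (mergeB A x y).2 (a + j) ↔
      wordB b y.1 y.2 i < wordB b y.1 y.2 j := by
  rw [mem_Icc] at hi hj
  obtain ⟨i, rfl⟩ := Nat.exists_eq_add_of_le' hi.1
  obtain ⟨j, rfl⟩ := Nat.exists_eq_add_of_le' hj.1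
  rw [wordB_mergeB_right A x y ⟨i, hi.2⟩, wordB_mergeB_right A x y ⟨j, hj.2⟩,
    wordB_add_one y.1 y.2 ⟨i, hi.2⟩, wordB_add_one y.1 y.2 ⟨j, hj.2⟩,
    signedVal_lt_signedVal_iff (OrderEmbedding.strictMono _)]

end Merge

theorem isAltDesZ_congr {w v : ℕ → ℤ} {i j : ℕ} (hpar : Even i ↔ Even j)
    (hlt : w i < w (i + 1) ↔ v j < v (j + 1)) (hgt : w (i + 1) < w i ↔ v (j + 1) < v j) :
    isAltDesZ w i ↔ isAltDesZ v j := by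
  simp only [isAltDesZ, ← Nat.not_even_iff_odd, hpar, hlt, hgt]

theorem isDownUpB_iff_forall_isAltDesZ {m : ℕ} (p : Equiv.Perm (Fin m) × (Fin m → Bool)) :
    isDownUpB m p.1 p.2 ↔ ∀ i ∈ Ico 1 m, isAltDesZ (wordB m p.1 p.2) i := by
  refine forall₂_congr fun i _ => ?_
  rcases Nat.even_or_odd i with h | h
  · simp [isAltDesZ, h, Nat.not_odd_iff_even.2 h]
  · simp [isAltDesZ, h, Nat.not_even_iff_odd.2 h]

theorem isDownUpB_negSigns_iff {m : ℕ} (p : Equiv.Perm (Fin m) × (Fin m → Bool)) :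
    isDownUpB m (negSigns m p).1 (negSigns m p).2 ↔
      ∀ i ∈ Ico 1 m, ¬ isAltDesZ (wordB m p.1 p.2) i := by
  refine forall₂_congr fun i hi => ?_
  have hne := wordB_ne_succ p.1 p.2 hi
  simp only [wordB_negSigns, neg_lt_neg_iff]
  rcases Nat.even_or_odd i with h | h
  · simp [isAltDesZ, h, Nat.not_odd_iff_even.2 h, hne.symm.le_iff_lt]
  · simp [isAltDesZ, h, Nat.not_even_iff_odd.2 h, hne.le_iff_lt]

theorem filter_isAltDesZ_subset_iff {n : ℕ} {w : ℕ → ℤ} (hw : w 0 = 0) (h1 : w 1 < 0)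
    (T : Finset ℕ) :
    (range n).filter (isAltDesZ w) ⊆ T ↔ ∀ i ∈ Ico 1 n, i ∉ T → ¬ isAltDesZ w i := by
  have h0 : ¬ isAltDesZ w 0 := by simp [isAltDesZ, hw, h1.le]
  constructor
  · intro h i hi hiT hdes
    exact hiT (h (by simp_all))
  · intro h i hi
    rw [mem_filter, mem_range] at hi
    by_contra hiT
    have : i ≠ 0 := by rintro rfl; exact h0 hi.2
    exact h i (mem_Ico.2 ⟨by omega, hi.1⟩) hiT hi.2

theorem wordB_zero {n : ℕ} (σ : Equiv.Perm (Fin n)) (ε : Fin n → Bool) : wordB n σ ε 0 = 0 := by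
  simp [wordB]

theorem card_filter_subset_empty (n : ℕ) :
    (univ.filter fun p : Equiv.Perm (Fin n) × (Fin n → Bool) =>
      wordB n p.1 p.2 1 < 0 ∧ (range n).filter (isAltDesZ (wordB n p.1 p.2)) ⊆ ∅).card =
      snakeCount n := by
  rw [snakeCount,
    ← card_filter_negSigns fun p => 0 < wordB n p.1 p.2 1 ∧ isDownUpB n p.1 p.2]
  congr 1
  refine filter_congr fun p _ => ?_
  rw [wordB_negSigns, neg_pos, isDownUpB_negSigns_iff]
  refine and_congr_right fun h1 => ?_
  rw [filter_isAltDesZ_subset_iff (wordB_zero _ _) h1]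
  simp

theorem card_filter_alternating_run (a m : ℕ) :
    (univ.filter fun p : Equiv.Perm (Fin m) × (Fin m → Bool) =>
      ∀ i ∈ Ico (1 : ℕ) m, Even a ↔ ¬ isAltDesZ (wordB m p.1 p.2) i).card = duBCount m := by
  by_cases ha : Even a
  · simp only [ha, true_iff, ← isDownUpB_negSigns_iff]
    exact card_filter_negSigns fun p => isDownUpB m p.1 p.2
  · simp only [ha, false_iff, not_not, ← isDownUpB_iff_forall_isAltDesZ]
    rfl

theorem isAltDesZ_mergeB_left {a b : ℕ} (A : {A : Finset (Fin (a + b)) // A.card = a})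
    (x : Equiv.Perm (Fin a) × (Fin a → Bool)) (y : Equiv.Perm (Fin b) × (Fin b → Bool))
    {i : ℕ} (hi : i ∈ Ico 1 a) :
    isAltDesZ (wordB (a + b) (mergeB A x y).1 (mergeB A x y).2) i ↔
      isAltDesZ (wordB a x.1 x.2) i := by
  have hi₁ : i ∈ Icc 1 a := by simp_all; omega
  have hi₂ : i + 1 ∈ Icc 1 a := by simp_all
  exact isAltDesZ_congr Iff.rfl (wordB_mergeB_lt_iff_left A x y hi₁ hi₂)
    (wordB_mergeB_lt_iff_left A x y hi₂ hi₁)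

theorem not_isAltDesZ_mergeB_right {a b : ℕ} (A : {A : Finset (Fin (a + b)) // A.card = a})
    (x : Equiv.Perm (Fin a) × (Fin a → Bool)) (y : Equiv.Perm (Fin b) × (Fin b → Bool))
    {i : ℕ} (hi : i ∈ Ico 1 b) :
    ¬ isAltDesZ (wordB (a + b) (mergeB A x y).1 (mergeB A x y).2) (a + i) ↔
      (Even a ↔ ¬ isAltDesZ (wordB b y.1 y.2) i) := by
  have hne := wordB_ne_succ y.1 y.2 hi
  have hi₁ : i ∈ Icc 1 b := by simp_all; omega
  have hi₂ : i + 1 ∈ Icc 1 b := by simp_all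
  have hlt := wordB_mergeB_lt_iff_right A x y hi₁ hi₂
  have hgt := wordB_mergeB_lt_iff_right A x y hi₂ hi₁
  simp only [isAltDesZ, ← Nat.not_even_iff_odd, Nat.even_add, add_assoc, hlt, hgt]
  have hasymm := lt_asymm (a := wordB b y.1 y.2 i) (b := wordB b y.1 y.2 (i + 1))
  have htotal := hne.lt_or_gt
  tauto

theorem card_filter_subset_insert {a b : ℕ} (ha : 0 < a) (hb : 0 < b) {T : Finset ℕ}
    (hT : ∀ i ∈ T, i < a) :
    (univ.filter fun p : Equiv.Perm (Fin (a + b)) × (Fin (a + b) → Bool) =>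
      wordB (a + b) p.1 p.2 1 < 0 ∧
        (range (a + b)).filter (isAltDesZ (wordB (a + b) p.1 p.2)) ⊆ insert a T).card =
      (a + b).choose a *
        ((univ.filter fun p : Equiv.Perm (Fin a) × (Fin a → Bool) =>
          wordB a p.1 p.2 1 < 0 ∧ (range a).filter (isAltDesZ (wordB a p.1 p.2)) ⊆ T).card *
          duBCount b) := by
  rw [← card_filter_alternating_run a b]
  refine card_filter_of_mergeB_iff _ _ _ fun A x y => ?_
  rw [and_assoc, wordB_mergeB_one_neg_iff ha]
  refine and_congr_right fun h1 => ?_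
  rw [filter_isAltDesZ_subset_iff (wordB_zero _ _) h1,
    filter_isAltDesZ_subset_iff (wordB_zero _ _) ((wordB_mergeB_one_neg_iff ha A x y).2 h1)]
  constructor
  · refine fun h => ⟨fun i hi hiT => ?_, fun i hi => ?_⟩
    · rw [← isAltDesZ_mergeB_left A x y hi]
      rw [mem_Ico] at hi
      exact h i (by simp; omega) (by simp [hiT]; omega)
    · rw [← not_isAltDesZ_mergeB_right A x y hi]
      rw [mem_Ico] at hi
      refine h _ (by simp; omega) ?_
      rw [mem_insert, not_or]
      exact ⟨by omega, fun hmem => by have := hT _ hmem; omega⟩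
  · rintro ⟨hx, hy⟩ i hi hiT
    rw [mem_insert, not_or] at hiT
    rw [mem_Ico] at hi
    rcases lt_or_gt_of_ne hiT.1 with hia | hia
    · have hmem : i ∈ Ico 1 a := mem_Ico.2 ⟨hi.1, hia⟩
      rw [isAltDesZ_mergeB_left A x y hmem]
      exact hx i hmem hiT.2
    · obtain ⟨j, rfl⟩ := Nat.exists_eq_add_of_le hia.le
      have hmem : j ∈ Ico 1 b := mem_Ico.2 ⟨by omega, by omega⟩
      rw [not_isAltDesZ_mergeB_right A x y hmem]
      exact hy j hmem

theorem bndFun_succ_of_le (n k : ℕ) (s : Fin (k + 1) → ℕ) {j : ℕ} (hj : j ≤ k + 1) :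
    bndFun n (k + 1) s j = bndFun (s (Fin.last k)) k (fun i => s i.castSucc) j := by
  unfold bndFun
  split_ifs with h₁ h₂ h₃ h₄ <;> try omega
  · rfl
  · congr 1
    ext
    simp
    omega

theorem compParts_castSucc (n k : ℕ) (s : Fin (k + 1) → ℕ) (j : Fin (k + 1)) :
    compParts n (k + 1) s j.castSucc =
      compParts (s (Fin.last k)) k (fun i => s i.castSucc) j := by
  have := j.isLt
  simp only [compParts, Fin.val_castSucc]
  rw [bndFun_succ_of_le, bndFun_succ_of_le] <;> omega

theorem compParts_last (n k : ℕ) (s : Fin (k + 1) → ℕ) :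
    compParts n (k + 1) s (Fin.last (k + 1)) = n - s (Fin.last k) := by
  simp [compParts, bndFun, Fin.last]

theorem compParts_zero_of_empty (n : ℕ) (s : Fin 0 → ℕ) (j : Fin 1) : compParts n 0 s j = n := by
  simp [compParts, bndFun]

theorem sum_compParts (n k : ℕ) (s : Fin k → ℕ) (hmono : StrictMono s) (hle : ∀ i, s i ≤ n) :
    ∑ j, compParts n k s j = n := by
  induction k generalizing n with
  | zero => simp [compParts_zero_of_empty]
  | succ k ih =>
    rw [Fin.sum_univ_castSucc, compParts_last]
    simp only [compParts_castSucc]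
    rw [ih _ (fun i => s i.castSucc) (hmono.comp Fin.strictMono_castSucc) fun i => (hmono i.castSucc_lt_last).le]
    exact Nat.add_sub_cancel' (hle _)

theorem multinomial_compParts_succ (n k : ℕ) (s : Fin (k + 1) → ℕ) (hmono : StrictMono s)
    (hle : ∀ i, s i ≤ n) :
    Nat.multinomial univ (compParts n (k + 1) s) =
      n.choose (s (Fin.last k)) *
        Nat.multinomial univ (compParts (s (Fin.last k)) k fun i => s i.castSucc) := by
  have hspec := Nat.multinomial_spec univ (compParts n (k + 1) s)
  have hspec' := Nat.multinomial_spec univ (compParts (s (Fin.last k)) k fun i => s i.castSucc)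
  rw [sum_compParts _ _ _ hmono hle, Fin.prod_univ_castSucc, compParts_last] at hspec
  simp only [compParts_castSucc] at hspec
  rw [sum_compParts _ _ (fun i => s i.castSucc) (hmono.comp Fin.strictMono_castSucc)
    fun i => (hmono i.castSucc_lt_last).le] at hspec'
  have hchoose := Nat.choose_mul_factorial_mul_factorial (hle (Fin.last k))
  rw [← hspec'] at hchoose
  refine Nat.eq_of_mul_eq_mul_left (Nat.mul_pos (prod_pos fun i _ => Nat.factorial_pos _)
    (Nat.factorial_pos _)) (hspec.trans ?_)
  rw [← hchoose]
  ring

/-- For `S̄ = {s₁ < ⋯ < s_k} ⊆ {1,...,n-1}`, the number `α̂_n⁻(S̄)` of type B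
permutations `σ` with `σ(1) < 0` and `D̂_B(σ) ⊆ S̄` equals the multinomial coefficient
`n!/(s₁!(s₂-s₁)!⋯(n-s_k)!)` times `S_{s₁} · DU^{(B)}_{s₂-s₁} ⋯ DU^{(B)}_{n-s_k}`. -/
theorem stmt14 (n k : ℕ) (hn : 0 < n) (s : Fin k → ℕ) (hmono : StrictMono s)
    (hrange : ∀ i, s i ∈ Finset.Ico 1 n) :
    (Finset.univ.filter fun p : Equiv.Perm (Fin n) × (Fin n → Bool) =>
        wordB n p.1 p.2 1 < 0 ∧
        (Finset.range n).filter (isAltDesZ (wordB n p.1 p.2)) ⊆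
          Finset.image s Finset.univ).card =
      Nat.multinomial Finset.univ (compParts n k s) *
        (snakeCount (compParts n k s 0) *
          ∏ j : Fin k, duBCount (compParts n k s j.succ)) := by
  induction k generalizing n with
  | zero =>
    simp only [univ_eq_empty, image_empty, prod_empty, mul_one]
    have hone : Nat.multinomial univ (compParts n 0 s) = 1 :=
      Nat.multinomial_singleton 0 (compParts n 0 s)
    rw [card_filter_subset_empty, compParts_zero_of_empty, hone, one_mul]
  | succ k ih =>
    have hlt : ∀ i : Fin k, s i.castSucc < s (Fin.last k) := fun i => hmono i.castSucc_lt_last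
    have hlast := mem_Ico.1 (hrange (Fin.last k))
    have himage : image s univ =
        insert (s (Fin.last k)) (image (fun i : Fin k => s i.castSucc) univ) := by
      ext i
      simp [Fin.exists_fin_succ', eq_comm, or_comm]
    rw [multinomial_compParts_succ n k s hmono fun i => (mem_Ico.1 (hrange i)).2.le,
      Fin.prod_univ_castSucc, himage, Fin.succ_last, compParts_last, ← Fin.castSucc_zero]
    simp only [Fin.succ_castSucc, compParts_castSucc]
    have ih := ih (s (Fin.last k)) hlast.1 (fun i => s i.castSucc)
      (hmono.comp Fin.strictMono_castSucc)
      fun i => mem_Ico.2 ⟨(mem_Ico.1 (hrange i.castSucc)).1, hlt i⟩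
    generalize hb : n - s (Fin.last k) = b
    obtain rfl : n = s (Fin.last k) + b := by omega
    rw [card_filter_subset_insert hlast.1 (by omega) (by simpa using hlt), ih]
    ring
end

section
/- For every positive integer n, the type B alternating Eulerian polynomials satisfy the differential recurrence B̂_{n+1}(x) = (n+1+x+n·x^2) B̂_n(x) + (1−x)(1+x^2) B̂_n'(x), as an identity of polynomials. -/
open Finset

/-- The type B alternating Eulerian polynomial `B̂_n` as a polynomial with real coefficients. -/
noncomputable def hatBpoly (n : ℕ) : Polynomial ℝ :=
  ∑ p : Equiv.Perm (Fin n) × (Fin n → Bool), Polynomial.X ^ altDesB n p.1 p.2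

/-- The permutation of `Fin (n + 1)` obtained from `σ` by inserting the largest value at
position `k`. -/
def insertMaxPerm {n : ℕ} (k : Fin (n + 1)) (σ : Equiv.Perm (Fin n)) :
    Equiv.Perm (Fin (n + 1)) :=
  (finSuccEquiv' k).trans ((Equiv.optionCongr σ).trans (finSuccEquiv' (Fin.last n)).symm)

lemma insertMaxPerm_self {n : ℕ} (k : Fin (n + 1)) (σ : Equiv.Perm (Fin n)) :
    insertMaxPerm k σ k = Fin.last n := by
  simp [insertMaxPerm]

lemma insertMaxPerm_succAbove {n : ℕ} (k : Fin (n + 1)) (σ : Equiv.Perm (Fin n)) (j : Fin n) :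
    insertMaxPerm k σ (k.succAbove j) = (σ j).castSucc := by
  simp [insertMaxPerm]

/-- The sign vector obtained from `ε` by inserting `b` at position `k` and flipping all signs
after it. -/
def insertSign {n : ℕ} (k : Fin (n + 1)) (b : Bool) (ε : Fin n → Bool) : Fin (n + 1) → Bool :=
  k.insertNth (α := fun _ => Bool) b fun j => if (j : ℕ) < k then ε j else !ε j

/-- Insertion of `±(n + 1)` into a signed permutation, negating all later entries. -/
def insertB (n : ℕ)
    (q : (Equiv.Perm (Fin n) × (Fin n → Bool)) × (Fin (n + 1) × Bool)) :
    Equiv.Perm (Fin (n + 1)) × (Fin (n + 1) → Bool) :=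
  (insertMaxPerm q.2.1 q.1.1, insertSign q.2.1 q.2.2 q.1.2)

lemma insertB_injective (n : ℕ) : Function.Injective (insertB n) := by
  rintro ⟨⟨σ, ε⟩, k, b⟩ ⟨⟨τ, δ⟩, l, c⟩ h
  simp only [insertB, Prod.mk.injEq] at h
  obtain ⟨hσ, hε⟩ := h
  have hkl : k = l := by
    apply (insertMaxPerm k σ).injective
    rw [insertMaxPerm_self, hσ, insertMaxPerm_self]
  subst hkl
  have hστ : σ = τ := by
    ext j
    have := congrArg (fun π => π (k.succAbove j)) hσ
    simp only [insertMaxPerm_succAbove] at this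
    simpa using congrArg Fin.val this
  have hbc : b = c := by
    simpa [insertSign] using congrFun hε k
  have hεδ : ε = δ := by
    ext j
    have := congrFun hε (k.succAbove j)
    simp only [insertSign, Fin.insertNth_apply_succAbove] at this
    split_ifs at this <;> simpa using this
  rw [hστ, hbc, hεδ]

lemma insertB_bijective (n : ℕ) : Function.Bijective (insertB n) := by
  rw [Fintype.bijective_iff_injective_and_card]
  refine ⟨insertB_injective n, ?_⟩
  simp only [Fintype.card_prod, Fintype.card_perm, Fintype.card_fin, Fintype.card_fun,
    Fintype.card_bool, Nat.factorial_succ, pow_succ]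
  ring

lemma wordB_lt (n : ℕ) (σ : Equiv.Perm (Fin n)) (ε : Fin n → Bool) (i : ℕ) :
    -((n : ℤ) + 1) < wordB n σ ε i ∧ wordB n σ ε i < (n : ℤ) + 1 := by
  unfold wordB
  split_ifs with h
  · have := (σ ⟨i - 1, by omega⟩).isLt
    constructor <;> omega
  · have := (σ ⟨i - 1, by omega⟩).isLt
    constructor <;> omega
  · constructor <;> omega

lemma wordB_insertB_of_le (n : ℕ) (σ : Equiv.Perm (Fin n)) (ε : Fin n → Bool)
    (k : Fin (n + 1)) (b : Bool) {i : ℕ} (hi : i ≤ k) :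
    wordB (n + 1) (insertMaxPerm k σ) (insertSign k b ε) i = wordB n σ ε i := by
  have hk := k.isLt
  unfold wordB
  by_cases h0 : 1 ≤ i
  · rw [dif_pos ⟨h0, by omega⟩, dif_pos ⟨h0, by omega⟩]
    have hidx : (⟨i - 1, by omega⟩ : Fin (n + 1)) = k.succAbove ⟨i - 1, by omega⟩ := by
      rw [Fin.succAbove_of_castSucc_lt _ _ (by simp [Fin.lt_def]; omega)]
      rfl
    rw [hidx, insertMaxPerm_succAbove, insertSign, Fin.insertNth_apply_succAbove,
      if_pos (show i - 1 < (k : ℕ) by omega)]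
    rfl
  · rw [dif_neg (by omega), dif_neg (by omega)]

lemma wordB_insertB_self (n : ℕ) (σ : Equiv.Perm (Fin n)) (ε : Fin n → Bool)
    (k : Fin (n + 1)) (b : Bool) :
    wordB (n + 1) (insertMaxPerm k σ) (insertSign k b ε) (k + 1) =
      if b then (n : ℤ) + 1 else -((n : ℤ) + 1) := by
  have hk := k.isLt
  unfold wordB
  rw [dif_pos ⟨by omega, by omega⟩]
  have hidx : (⟨(k : ℕ) + 1 - 1, by omega⟩ : Fin (n + 1)) = k := by ext; simp
  rw [hidx, insertMaxPerm_self, insertSign, Fin.insertNth_apply_same]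
  rfl

lemma wordB_insertB_of_lt (n : ℕ) (σ : Equiv.Perm (Fin n)) (ε : Fin n → Bool)
    (k : Fin (n + 1)) (b : Bool) {i : ℕ} (hi : (k : ℕ) < i) (hin : i ≤ n) :
    wordB (n + 1) (insertMaxPerm k σ) (insertSign k b ε) (i + 1) = -wordB n σ ε i := by
  have hk := k.isLt
  unfold wordB
  rw [dif_pos ⟨by omega, by omega⟩, dif_pos ⟨by omega, by omega⟩]
  have hidx : (⟨i + 1 - 1, by omega⟩ : Fin (n + 1)) = k.succAbove ⟨i - 1, by omega⟩ := by
    rw [Fin.succAbove_of_le_castSucc _ _ (by simp [Fin.le_def]; omega)]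
    ext
    simp
    omega
  rw [hidx, insertMaxPerm_succAbove, insertSign, Fin.insertNth_apply_succAbove,
    if_neg (show ¬ i - 1 < (k : ℕ) by omega)]
  cases ε ⟨i - 1, by omega⟩ <;> simp

lemma card_filter_range_succ (P : ℕ → Prop) [DecidablePred P] (m : ℕ) :
    ((range (m + 1)).filter P).card = ((range m).filter P).card + if P m then 1 else 0 := by
  simp only [card_filter, sum_range_succ]

section Counting

variable {w v : ℕ → ℤ} {n k : ℕ} {b : Bool} {N : ℤ}

lemma card_isAltDesZ_insert_prefix (hle : ∀ i ≤ k, v i = w i)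
    (hself : v (k + 1) = if b then N else -N) (hN : ∀ i, -N < w i ∧ w i < N) :
    ((range (k + 1)).filter (isAltDesZ v)).card =
      ((range k).filter (isAltDesZ w)).card + if b = decide (Even k) then 1 else 0 := by
  rw [card_filter_range_succ]
  congr 1
  · congr 1
    refine filter_congr fun i hi => ?_
    rw [mem_range] at hi
    simp only [isAltDesZ, hle i hi.le, hle (i + 1) hi]
  · have h := hN k
    have hiff : isAltDesZ v k ↔ b = decide (Even k) := by
      simp only [isAltDesZ, hle k le_rfl, hself, ← Nat.not_even_iff_odd]
      by_cases he : Even k <;> cases b <;> simp [he] <;> omega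
    simp only [hiff]

lemma card_isAltDesZ_insert (hkn : k < n) (hle : ∀ i ≤ k, v i = w i)
    (hself : v (k + 1) = if b then N else -N) (hlt : ∀ i, k < i → i ≤ n → v (i + 1) = -w i)
    (hN : ∀ i, -N < w i ∧ w i < N) :
    ((range (n + 1)).filter (isAltDesZ v)).card + (if isAltDesZ w k then 1 else 0) =
      ((range n).filter (isAltDesZ w)).card + if b = decide (Even k) then 2 else 0 := by
  induction n, Nat.succ_le_of_lt hkn using Nat.le_induction with
  | base =>
    have hiff : isAltDesZ v (k + 1) ↔ b = decide (Even k) := by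
      have h := hN (k + 1)
      simp only [isAltDesZ, hlt (k + 1) (by omega) le_rfl, hself, ← Nat.not_even_iff_odd,
        Nat.even_add_one]
      by_cases he : Even k <;> cases b <;> simp [he] <;> omega
    rw [Nat.succ_eq_add_one, card_filter_range_succ _ (k + 1),
      card_isAltDesZ_insert_prefix hle hself hN, card_filter_range_succ _ k]
    simp only [hiff]
    split_ifs <;> omega
  | succ m hm ih =>
    have hiff : isAltDesZ v (m + 1) ↔ isAltDesZ w m := by
      simp only [isAltDesZ, hlt m hm (by omega), hlt (m + 1) (by omega) le_rfl,
        ← Nat.not_even_iff_odd, Nat.even_add_one, neg_lt_neg_iff]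
      tauto
    rw [card_filter_range_succ _ (m + 1), card_filter_range_succ (isAltDesZ w) m]
    simp only [hiff]
    have := ih hm fun i hi him => hlt i hi (by omega)
    omega

end Counting

open Polynomial in
lemma sum_altDesB_insertB_castSucc (n : ℕ) (p : Equiv.Perm (Fin n) × (Fin n → Bool))
    (k : Fin n) :
    ∑ b : Bool, (X : ℝ[X]) ^ altDesB (n + 1) (insertB n (p, k.castSucc, b)).1
        (insertB n (p, k.castSucc, b)).2 =
      (1 + X ^ 2) * if isAltDesZ (wordB n p.1 p.2) k then X ^ (altDesB n p.1 p.2 - 1)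
        else X ^ altDesB n p.1 p.2 := by
  have key (b : Bool) := card_isAltDesZ_insert (b := b) k.isLt
    (fun i hi => wordB_insertB_of_le n p.1 p.2 k.castSucc b hi)
    (wordB_insertB_self n p.1 p.2 k.castSucc b)
    (fun i hi hin => wordB_insertB_of_lt n p.1 p.2 k.castSucc b hi hin)
    (wordB_lt n p.1 p.2)
  have key' (b : Bool) : altDesB (n + 1) (insertB n (p, k.castSucc, b)).1
      (insertB n (p, k.castSucc, b)).2 + (if isAltDesZ (wordB n p.1 p.2) k then 1 else 0) =
      altDesB n p.1 p.2 + if b = decide (Even (k : ℕ)) then 2 else 0 := key b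
  have ht := key' true
  have hf := key' false
  rw [Fintype.sum_bool]
  generalize altDesB (n + 1) _ (insertB n (p, k.castSucc, true)).2 = dt at *
  generalize altDesB (n + 1) _ (insertB n (p, k.castSucc, false)).2 = df at *
  generalize altDesB n p.1 p.2 = d at *
  by_cases he : Even (k : ℕ) <;> by_cases hd : isAltDesZ (wordB n p.1 p.2) k <;>
    simp only [he, hd, decide_true, decide_false, if_true, if_false, reduceCtorEq] at ht hf ⊢
  · obtain rfl : d = df + 1 := by omega
    obtain rfl : dt = df + 2 := by omega
    simp only [Nat.add_sub_cancel]; ring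
  · obtain rfl : d = df := by omega
    obtain rfl : dt = d + 2 := by omega
    ring
  · obtain rfl : d = dt + 1 := by omega
    obtain rfl : df = dt + 2 := by omega
    simp only [Nat.add_sub_cancel]; ring
  · obtain rfl : d = dt := by omega
    obtain rfl : df = d + 2 := by omega
    ring

open Polynomial in
lemma sum_altDesB_insertB_last (n : ℕ) (p : Equiv.Perm (Fin n) × (Fin n → Bool)) :
    ∑ b : Bool, (X : ℝ[X]) ^ altDesB (n + 1) (insertB n (p, Fin.last n, b)).1
        (insertB n (p, Fin.last n, b)).2 =
      (1 + X) * X ^ altDesB n p.1 p.2 := by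
  have key (b : Bool) : altDesB (n + 1) (insertB n (p, Fin.last n, b)).1
      (insertB n (p, Fin.last n, b)).2 =
      altDesB n p.1 p.2 + if b = decide (Even n) then 1 else 0 :=
    card_isAltDesZ_insert_prefix
      (fun i hi => wordB_insertB_of_le n p.1 p.2 (Fin.last n) b hi)
      (wordB_insertB_self n p.1 p.2 (Fin.last n) b) (wordB_lt n p.1 p.2)
  rw [Fintype.sum_bool, key, key]
  by_cases he : Even n <;> simp [he] <;> ring

open Polynomial in
lemma sum_altDesB_insertB (n : ℕ) (p : Equiv.Perm (Fin n) × (Fin n → Bool)) :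
    ∑ q : Fin (n + 1) × Bool, (X : ℝ[X]) ^ altDesB (n + 1) (insertB n (p, q)).1
        (insertB n (p, q)).2 =
      (C ((n : ℝ) + 1) + X + C (n : ℝ) * X ^ 2) * X ^ altDesB n p.1 p.2 +
        (1 - X) * (1 + X ^ 2) * derivative (X ^ altDesB n p.1 p.2) := by
  rw [Fintype.sum_prod_type, Fin.sum_univ_castSucc, sum_altDesB_insertB_last]
  simp only [sum_altDesB_insertB_castSucc]
  rw [← mul_sum, Fin.sum_univ_eq_sum_range (fun k => if isAltDesZ (wordB n p.1 p.2) k then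
    (X : ℝ[X]) ^ (altDesB n p.1 p.2 - 1) else X ^ altDesB n p.1 p.2), sum_ite, sum_const,
    sum_const]
  have hcard := card_filter_add_card_filter_not (s := range n) (isAltDesZ (wordB n p.1 p.2))
  rw [card_range] at hcard
  change altDesB n p.1 p.2 + _ = n at hcard
  change (1 + X ^ 2) * (altDesB n p.1 p.2 • _ + _) + _ = _
  generalize altDesB n p.1 p.2 = d at *
  generalize ((range n).filter fun i => ¬ isAltDesZ (wordB n p.1 p.2) i).card = e at *
  subst hcard
  rw [derivative_X_pow]
  rcases d with _ | d
  · simp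
    ring
  · simp only [nsmul_eq_mul, Nat.add_sub_cancel, Nat.cast_add, Nat.cast_one, map_add, map_one,
      map_natCast]
    ring

/-- For every positive integer `n`,
`B̂_{n+1}(x) = (n+1+x+n·x²) B̂_n(x) + (1-x)(1+x²) B̂_n'(x)` as polynomials. -/
theorem stmt18 (n : ℕ) (hn : 0 < n) :
    hatBpoly (n + 1) =
      (Polynomial.C ((n : ℝ) + 1) + Polynomial.X + Polynomial.C (n : ℝ) * Polynomial.X ^ 2) *
          hatBpoly n +
        (1 - Polynomial.X) * (1 + Polynomial.X ^ 2) * Polynomial.derivative (hatBpoly n) := by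
  simp only [hatBpoly]
  rw [← (insertB_bijective n).sum_comp fun r => (Polynomial.X : Polynomial ℝ) ^
    altDesB (n + 1) r.1 r.2, Fintype.sum_prod_type]
  simp only [sum_altDesB_insertB, sum_add_distrib, ← mul_sum, Polynomial.derivative_sum]
end

section
/- For every positive integer n and every integer k ≥ 0, the coefficients B̂(n,k) satisfy B̂(n+1,k) = (n+1−k)(B̂(n,k) + B̂(n,k−2)) + k(B̂(n,k+1) + B̂(n,k−1)) + B̂(n,k+1) + B̂(n,k−2), where B̂(n,j) = 0 for j < 0 or j > n; moreover B̂(n,0) equals the number of snakes of length n. -/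
open Finset

/-- `B̂(n,k)`: the number of type B permutations of order `n` with exactly `k` type B
alternating descents (zero for `k < 0` or `k > n`). -/
def hatBnk (n : ℕ) (k : ℤ) : ℕ :=
  (Finset.univ.filter fun p : Equiv.Perm (Fin n) × (Fin n → Bool) =>
    (altDesB n p.1 p.2 : ℤ) = k).card

/-- The number of alternating descent positions of a word among `{0,...,n-1}`. -/
def altDesCount (n : ℕ) (w : ℕ → ℤ) : ℕ := ((range n).filter (isAltDesZ w)).card

theorem altDesCount_eq_sum (n : ℕ) (w : ℕ → ℤ) :
    altDesCount n w = ∑ i ∈ range n, if isAltDesZ w i then 1 else 0 := by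
  rw [altDesCount, card_filter]

theorem isAltDesZ_congr_s19 {w v : ℕ → ℤ} {i : ℕ} (h : v i = w i) (h' : v (i + 1) = w (i + 1)) :
    isAltDesZ v i ↔ isAltDesZ w i := by
  simp [isAltDesZ, h, h']

/-- Shifting a word by one position and negating it preserves alternating descents. -/
theorem isAltDesZ_succ_of_neg {w v : ℕ → ℤ} {i : ℕ} (h : v (i + 1) = -w i)
    (h' : v (i + 1 + 1) = -w (i + 1)) : isAltDesZ v (i + 1) ↔ isAltDesZ w i := by
  simp only [isAltDesZ, h, h', neg_lt_neg_iff, Nat.even_add_one, Nat.odd_add_one,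
    Nat.not_even_iff_odd, Nat.not_odd_iff_even]
  tauto

theorem isAltDesZ_of_lt_abs_right {v : ℕ → ℤ} {i : ℕ} (h : |v i| < |v (i + 1)|) :
    isAltDesZ v i ↔ (0 < v (i + 1) ↔ Even i) := by
  have h1 := abs_lt.mp h
  rcases Nat.even_or_odd i with he | ho
  · have : ¬ Odd i := Nat.not_odd_iff_even.mpr he
    simp only [isAltDesZ, he, this]
    rcases abs_cases (v (i + 1)) with h2 | h2 <;> grind
  · have : ¬ Even i := Nat.not_even_iff_odd.mpr ho
    simp only [isAltDesZ, ho, this]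
    rcases abs_cases (v (i + 1)) with h2 | h2 <;> grind

theorem isAltDesZ_of_lt_abs_left {v : ℕ → ℤ} {i : ℕ} (h : |v (i + 1)| < |v i|) :
    isAltDesZ v i ↔ (0 < v i ↔ Odd i) := by
  have h1 := abs_lt.mp h
  rcases Nat.even_or_odd i with he | ho
  · have : ¬ Odd i := Nat.not_odd_iff_even.mpr he
    simp only [isAltDesZ, he, this]
    rcases abs_cases (v i) with h2 | h2 <;> grind
  · have : ¬ Even i := Nat.not_even_iff_odd.mpr ho
    simp only [isAltDesZ, ho, this]
    rcases abs_cases (v i) with h2 | h2 <;> grind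

/-- Effect on the alternating descents of inserting a letter of dominant absolute value in the
gap after position `p` and negating all later letters. -/
theorem altDesCount_insert {w v : ℕ → ℤ} {p m : ℕ}
    (hle : ∀ i ≤ p, v i = w i) (hgt : ∀ i, p < i → i ≤ p + 1 + m → v (i + 1) = -w i)
    (hM : ∀ i, |w i| < |v (p + 1)|) :
    altDesCount (p + 1 + m + 1) v + (if isAltDesZ w p then 1 else 0) =
      altDesCount (p + 1 + m) w + if (0 < v (p + 1) ↔ Even p) then 2 else 0 := by
  have e1 : isAltDesZ v p ↔ (0 < v (p + 1) ↔ Even p) :=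
    isAltDesZ_of_lt_abs_right (by rw [hle p le_rfl]; exact hM p)
  have e2 : isAltDesZ v (p + 1) ↔ (0 < v (p + 1) ↔ Even p) := by
    rw [isAltDesZ_of_lt_abs_left, Nat.odd_add_one, Nat.not_odd_iff_even]
    rw [hgt (p + 1) (by omega) (by omega), abs_neg]
    exact hM _
  have e3 : ∑ i ∈ range p, (if isAltDesZ v i then 1 else 0) =
      ∑ i ∈ range p, if isAltDesZ w i then 1 else 0 :=
    sum_congr rfl fun i hi => by
      rw [mem_range] at hi
      simp only [isAltDesZ_congr_s19 (hle i hi.le) (hle (i + 1) hi)]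
  have e4 : ∑ i ∈ range m, (if isAltDesZ v (p + 1 + 1 + i) then 1 else 0) =
      ∑ i ∈ range m, if isAltDesZ w (p + 1 + i) then 1 else 0 :=
    sum_congr rfl fun i hi => by
      rw [mem_range] at hi
      have h := isAltDesZ_succ_of_neg (hgt (p + 1 + i) (by omega) (by omega))
        (hgt (p + 1 + i + 1) (by omega) (by omega))
      simp only [show p + 1 + 1 + i = p + 1 + i + 1 by ring, h]
  rw [altDesCount_eq_sum, altDesCount_eq_sum, show p + 1 + m + 1 = p + 1 + 1 + m by ring,
    sum_range_add _ (p + 1 + 1) m, sum_range_add _ (p + 1) m, sum_range_succ,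
    sum_range_succ, sum_range_succ, e3, e4]
  simp only [e1, e2]
  split_ifs <;> ring

/-- Effect on the alternating descents of appending a letter of dominant absolute value. -/
theorem altDesCount_append {w v : ℕ → ℤ} {n : ℕ} (hle : ∀ i ≤ n, v i = w i)
    (hM : ∀ i, |w i| < |v (n + 1)|) :
    altDesCount (n + 1) v = altDesCount n w + if (0 < v (n + 1) ↔ Even n) then 1 else 0 := by
  have e1 : isAltDesZ v n ↔ (0 < v (n + 1) ↔ Even n) :=
    isAltDesZ_of_lt_abs_right (by rw [hle n le_rfl]; exact hM n)
  rw [altDesCount_eq_sum, altDesCount_eq_sum, sum_range_succ]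
  simp only [e1]
  congr 1
  refine sum_congr rfl fun i hi => ?_
  rw [mem_range] at hi
  simp only [isAltDesZ_congr_s19 (hle i hi.le) (hle (i + 1) hi)]

/-- Type B permutations encoded as a permutation together with a sign vector. -/
abbrev SignedPerm (n : ℕ) : Type := Equiv.Perm (Fin n) × (Fin n → Bool)

theorem wordB_succ {n : ℕ} (σ : Equiv.Perm (Fin n)) (ε : Fin n → Bool) (j : Fin n) :
    wordB n σ ε (j + 1) = if ε j then ((σ j : ℕ) + 1 : ℤ) else -((σ j : ℕ) + 1 : ℤ) := by
  have h : 1 ≤ (j : ℕ) + 1 ∧ (j : ℕ) + 1 ≤ n := ⟨by omega, j.isLt⟩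
  simp only [wordB, dif_pos h, Nat.add_sub_cancel, Fin.eta]

theorem abs_wordB_lt {n : ℕ} (σ : Equiv.Perm (Fin n)) (ε : Fin n → Bool) (i : ℕ) :
    |wordB n σ ε i| < n + 1 := by
  unfold wordB
  split_ifs with h
  · have := (σ ⟨i - 1, by omega⟩).isLt
    rw [abs_lt]; omega
  · have := (σ ⟨i - 1, by omega⟩).isLt
    rw [abs_lt]; omega
  · rw [abs_zero]; omega

/-- Insert the largest value at position `p` of a permutation. -/
def insertMax {n : ℕ} (p : Fin (n + 1)) (σ : Equiv.Perm (Fin n)) : Equiv.Perm (Fin (n + 1)) :=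
  (finSuccEquiv' p).trans ((Equiv.optionCongr σ).trans (finSuccEquiv' (Fin.last n)).symm)

@[simp] theorem insertMax_self {n : ℕ} (p : Fin (n + 1)) (σ : Equiv.Perm (Fin n)) :
    insertMax p σ p = Fin.last n := by
  simp [insertMax]

@[simp] theorem insertMax_succAbove {n : ℕ} (p : Fin (n + 1)) (σ : Equiv.Perm (Fin n))
    (j : Fin n) : insertMax p σ (p.succAbove j) = (σ j).castSucc := by
  simp [insertMax]

/-- Insert the letter `±(n+1)`, with sign `s`, at position `p` of a type B permutation, and
negate all later letters. -/
def insertNeg {n : ℕ} (x : (Fin (n + 1) × Bool) × SignedPerm n) : SignedPerm (n + 1) :=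
  (insertMax x.1.1 x.2.1,
    Fin.insertNth (α := fun _ => Bool) x.1.1 x.1.2
      fun j => if (j : ℕ) < x.1.1 then x.2.2 j else !x.2.2 j)

theorem insertNeg_injective (n : ℕ) : Function.Injective (insertNeg (n := n)) := by
  rintro ⟨⟨p, s⟩, σ, ε⟩ ⟨⟨q, t⟩, τ, δ⟩ h
  obtain ⟨h1, h2⟩ := Prod.ext_iff.mp h
  simp only [insertNeg] at h1 h2
  obtain rfl : p = q := (insertMax q τ).injective <| by
    rw [insertMax_self, ← h1, insertMax_self]
  obtain rfl : σ = τ := Equiv.ext fun j => Fin.castSucc_injective n <| by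
    rw [← insertMax_succAbove p σ, h1, insertMax_succAbove]
  obtain rfl : s = t := by simpa using congrFun h2 p
  obtain rfl : ε = δ := funext fun j => by
    have := congrFun h2 (p.succAbove j)
    simp only [Fin.insertNth_apply_succAbove] at this
    split_ifs at this
    · exact this
    · exact Bool.not_inj this
  rfl

theorem insertNeg_bijective (n : ℕ) : Function.Bijective (insertNeg (n := n)) := by
  rw [Fintype.bijective_iff_injective_and_card]
  refine ⟨insertNeg_injective n, ?_⟩
  simp only [Fintype.card_prod, Fintype.card_fin, Fintype.card_bool, Fintype.card_perm,
    Fintype.card_fun, Nat.factorial_succ, pow_succ]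
  ring

theorem wordB_insertNeg_self {n : ℕ} (p : Fin (n + 1)) (s : Bool) (x : SignedPerm n) :
    wordB (n + 1) (insertNeg ((p, s), x)).1 (insertNeg ((p, s), x)).2 (p + 1) =
      if s then (n + 1 : ℤ) else -(n + 1 : ℤ) := by
  rw [wordB_succ]
  simp [insertNeg]

theorem wordB_insertNeg_of_le {n : ℕ} (p : Fin (n + 1)) (s : Bool) (x : SignedPerm n)
    {i : ℕ} (hi : i ≤ p) :
    wordB (n + 1) (insertNeg ((p, s), x)).1 (insertNeg ((p, s), x)).2 i =
      wordB n x.1 x.2 i := by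
  obtain _ | i := i
  · simp [wordB_zero]
  have hp := p.isLt
  let j : Fin n := ⟨i, by omega⟩
  have hj : p.succAbove j = j.castSucc := Fin.succAbove_of_castSucc_lt p j hi
  have h1 := wordB_succ (insertNeg ((p, s), x)).1 (insertNeg ((p, s), x)).2 (p.succAbove j)
  have h2 := wordB_succ x.1 x.2 j
  have hlt : (j : ℕ) < p := hi
  simp only [insertNeg, insertMax_succAbove, Fin.insertNth_apply_succAbove, hlt, if_true,
    Fin.val_castSucc] at h1
  rw [← h2, hj] at h1
  exact h1

theorem wordB_insertNeg_of_gt {n : ℕ} (p : Fin (n + 1)) (s : Bool) (x : SignedPerm n)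
    {i : ℕ} (hp : p < i) (hi : i ≤ n) :
    wordB (n + 1) (insertNeg ((p, s), x)).1 (insertNeg ((p, s), x)).2 (i + 1) =
      -wordB n x.1 x.2 i := by
  obtain _ | i := i
  · omega
  let j : Fin n := ⟨i, hi⟩
  have hj : p.succAbove j = j.succ :=
    Fin.succAbove_of_le_castSucc p j (Fin.le_def.mpr (Nat.lt_succ_iff.mp hp))
  have h1 := wordB_succ (insertNeg ((p, s), x)).1 (insertNeg ((p, s), x)).2 (p.succAbove j)
  have h2 := wordB_succ x.1 x.2 j
  have hlt : ¬ (j : ℕ) < p := by simp only [j]; omega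
  simp only [insertNeg, insertMax_succAbove, Fin.insertNth_apply_succAbove, hlt, if_false,
    Fin.val_castSucc] at h1
  rw [hj] at h1
  refine h1.trans ?_
  change _ = -wordB n x.1 x.2 (j + 1)
  rw [h2]
  cases x.2 j <;> simp

theorem abs_wordB_lt_insertNeg {n : ℕ} (p : Fin (n + 1)) (s : Bool) (x : SignedPerm n) (i : ℕ) :
    |wordB n x.1 x.2 i| <
      |wordB (n + 1) (insertNeg ((p, s), x)).1 (insertNeg ((p, s), x)).2 (p + 1)| := by
  rw [wordB_insertNeg_self]
  have h := abs_wordB_lt x.1 x.2 i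
  have h0 : |(n + 1 : ℤ)| = n + 1 := abs_of_nonneg (by positivity)
  cases s
  · simpa only [Bool.false_eq_true, if_false, abs_neg, h0] using h
  · simpa only [if_true, h0] using h

theorem wordB_insertNeg_self_pos {n : ℕ} (p : Fin (n + 1)) (s : Bool) (x : SignedPerm n) :
    0 < wordB (n + 1) (insertNeg ((p, s), x)).1 (insertNeg ((p, s), x)).2 (p + 1) ↔
      s = true := by
  rw [wordB_insertNeg_self]
  cases s <;> simp

theorem altDesB_insertNeg_castSucc {n : ℕ} (p : Fin n) (s : Bool) (x : SignedPerm n) :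
    altDesB (n + 1) (insertNeg ((p.castSucc, s), x)).1 (insertNeg ((p.castSucc, s), x)).2 +
        (if isAltDesZ (wordB n x.1 x.2) p then 1 else 0) =
      altDesB n x.1 x.2 + if (s = true ↔ Even (p : ℕ)) then 2 else 0 := by
  obtain ⟨m, hm⟩ := Nat.exists_eq_add_of_lt p.isLt
  have hm' : n = p + 1 + m := by omega
  have key := altDesCount_insert (p := p) (m := m) (w := wordB n x.1 x.2)
    (v := wordB (n + 1) (insertNeg ((p.castSucc, s), x)).1 (insertNeg ((p.castSucc, s), x)).2)
    (fun i hi => wordB_insertNeg_of_le p.castSucc s x hi)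
    (fun i hp hi => wordB_insertNeg_of_gt p.castSucc s x hp (hi.trans hm'.ge))
    (abs_wordB_lt_insertNeg p.castSucc s x)
  have hpos := wordB_insertNeg_self_pos p.castSucc s x
  rw [Fin.val_castSucc] at hpos
  simp only [hpos] at key
  rw [← hm'] at key
  exact key

theorem altDesB_insertNeg_last {n : ℕ} (s : Bool) (x : SignedPerm n) :
    altDesB (n + 1) (insertNeg ((Fin.last n, s), x)).1 (insertNeg ((Fin.last n, s), x)).2 =
      altDesB n x.1 x.2 + if (s = true ↔ Even n) then 1 else 0 := by
  have key := altDesCount_append (n := n) (w := wordB n x.1 x.2)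
    (v := wordB (n + 1) (insertNeg ((Fin.last n, s), x)).1 (insertNeg ((Fin.last n, s), x)).2)
    (fun i hi => wordB_insertNeg_of_le (Fin.last n) s x hi)
    (abs_wordB_lt_insertNeg (Fin.last n) s x)
  have hpos := wordB_insertNeg_self_pos (Fin.last n) s x
  rw [Fin.val_last] at hpos
  simp only [hpos] at key
  exact key

theorem hatBnk_eq_sum (n : ℕ) (k : ℤ) :
    (hatBnk n k : ℤ) = ∑ x : SignedPerm n, if (altDesB n x.1 x.2 : ℤ) = k then 1 else 0 := by
  rw [hatBnk, card_filter]
  push_cast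
  rfl

theorem sum_bool_castSucc {n : ℕ} (p : Fin n) (x : SignedPerm n) (k : ℤ) :
    (∑ s : Bool, if (altDesB (n + 1) (insertNeg ((p.castSucc, s), x)).1
        (insertNeg ((p.castSucc, s), x)).2 : ℤ) = k then (1 : ℤ) else 0) =
      if isAltDesZ (wordB n x.1 x.2) p then
        (if (altDesB n x.1 x.2 : ℤ) = k + 1 then 1 else 0) +
          (if (altDesB n x.1 x.2 : ℤ) = k - 1 then 1 else 0)
      else
        (if (altDesB n x.1 x.2 : ℤ) = k then 1 else 0) +
          (if (altDesB n x.1 x.2 : ℤ) = k - 2 then 1 else 0) := by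
  have h1 := altDesB_insertNeg_castSucc p true x
  have h2 := altDesB_insertNeg_castSucc p false x
  rw [Fintype.sum_bool]
  simp only [true_iff, Bool.false_eq_true, false_iff] at h1 h2
  by_cases he : Even (p : ℕ) <;> by_cases ha : isAltDesZ (wordB n x.1 x.2) p <;>
    simp only [he, ha, if_true, if_false, not_true, not_false_iff] at h1 h2 ⊢ <;>
    split_ifs <;> omega

theorem sum_bool_last {n : ℕ} (x : SignedPerm n) (k : ℤ) :
    (∑ s : Bool, if (altDesB (n + 1) (insertNeg ((Fin.last n, s), x)).1
        (insertNeg ((Fin.last n, s), x)).2 : ℤ) = k then (1 : ℤ) else 0) =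
      (if (altDesB n x.1 x.2 : ℤ) = k then 1 else 0) +
        (if (altDesB n x.1 x.2 : ℤ) = k - 1 then 1 else 0) := by
  have h1 := altDesB_insertNeg_last true x
  have h2 := altDesB_insertNeg_last false x
  rw [Fintype.sum_bool]
  simp only [true_iff, Bool.false_eq_true, false_iff] at h1 h2
  by_cases he : Even n <;>
    simp only [he, if_true, if_false, not_true, not_false_iff] at h1 h2 ⊢ <;>
    split_ifs <;> omega

theorem sum_ite_isAltDesZ (n : ℕ) (x : SignedPerm n) (a b : ℤ) :
    (∑ p : Fin n, if isAltDesZ (wordB n x.1 x.2) p then a else b) =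
      altDesB n x.1 x.2 * a + (n - altDesB n x.1 x.2) * b := by
  rw [Fin.sum_univ_eq_sum_range (fun i => if isAltDesZ (wordB n x.1 x.2) i then a else b) n,
    sum_ite, sum_const, sum_const, nsmul_eq_mul, nsmul_eq_mul]
  have h := card_filter_add_card_filter_not (s := range n) (isAltDesZ (wordB n x.1 x.2))
  rw [card_range, ← Nat.cast_inj (R := ℤ), Nat.cast_add] at h
  rw [altDesB, ← eq_sub_iff_add_eq'.mpr h]

theorem hatBnk_succ (n : ℕ) (k : ℤ) :
    (hatBnk (n + 1) k : ℤ) =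
      ((n : ℤ) + 1 - k) * ((hatBnk n k : ℤ) + (hatBnk n (k - 2) : ℤ)) +
        k * ((hatBnk n (k + 1) : ℤ) + (hatBnk n (k - 1) : ℤ)) +
        (hatBnk n (k + 1) : ℤ) + (hatBnk n (k - 2) : ℤ) := by
  simp only [hatBnk_eq_sum]
  rw [← (insertNeg_bijective n).sum_comp, Fintype.sum_prod_type_right]
  simp only [← sum_add_distrib, mul_sum]
  refine sum_congr rfl fun x _ => ?_
  rw [Fintype.sum_prod_type, Fin.sum_univ_castSucc, sum_bool_last]
  simp only [sum_bool_castSucc]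
  rw [sum_ite_isAltDesZ]
  generalize (altDesB n x.1 x.2 : ℤ) = d
  split_ifs <;> omega

/-- Negate all letters of a type B permutation. -/
def negAll (n : ℕ) : SignedPerm n ≃ SignedPerm n :=
  (Equiv.refl _).prodCongr ((Equiv.refl _).arrowCongr Equiv.boolNot)

theorem wordB_negAll {n : ℕ} (x : SignedPerm n) (i : ℕ) :
    wordB n (negAll n x).1 (negAll n x).2 i = -wordB n x.1 x.2 i := by
  unfold wordB
  split_ifs <;> simp_all [negAll]

theorem wordB_succ_ne {n : ℕ} (x : SignedPerm n) {i : ℕ} (hi : i < n) :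
    wordB n x.1 x.2 i ≠ wordB n x.1 x.2 (i + 1) := by
  have h2 := wordB_succ x.1 x.2 ⟨i, hi⟩
  simp only at h2
  rw [h2]
  obtain _ | i := i
  · rw [wordB_zero]; split_ifs <;> omega
  · have h1 := wordB_succ x.1 x.2 ⟨i, by omega⟩
    simp only at h1
    rw [h1]
    have hne : (x.1 ⟨i, by omega⟩ : ℕ) ≠ x.1 ⟨i + 1, hi⟩ := fun h => by
      simpa using x.1.injective (Fin.ext h)
    split_ifs <;> omega

theorem altDesB_eq_zero_iff {n : ℕ} (hn : 0 < n) (x : SignedPerm n) :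
    altDesB n x.1 x.2 = 0 ↔
      0 < wordB n (negAll n x).1 (negAll n x).2 1 ∧
        isDownUpB n (negAll n x).1 (negAll n x).2 := by
  simp only [altDesB, card_eq_zero, filter_eq_empty_iff, mem_range, isDownUpB, mem_Ico,
    wordB_negAll, isAltDesZ, neg_lt_neg_iff]
  constructor
  · intro h
    refine ⟨?_, fun i hi => ⟨fun ho => ?_, fun he => ?_⟩⟩
    · have h0 := @h 0 hn
      have hne := wordB_succ_ne x hn
      simp only [wordB_zero, zero_add] at h0 hne
      grind
    · have h0 := @h i hi.2
      have hne := wordB_succ_ne x hi.2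
      grind
    · have h0 := @h i hi.2
      have hne := wordB_succ_ne x hi.2
      grind
  · rintro ⟨h0, h⟩ i hi
    obtain _ | i := i
    · simp [wordB_zero]; omega
    · have := h (i + 1) ⟨by omega, hi⟩
      rintro (⟨he, hlt⟩ | ⟨ho, hlt⟩)
      · exact (this.2 he).not_gt hlt
      · exact (this.1 ho).not_gt hlt

theorem hatBnk_zero_eq_snakeCount {n : ℕ} (hn : 0 < n) : hatBnk n 0 = snakeCount n := by
  refine card_equiv (negAll n) fun x => ?_
  simp only [mem_filter, mem_univ, true_and, Nat.cast_eq_zero]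
  exact altDesB_eq_zero_iff hn x

/-- For every positive integer `n` and integer `k ≥ 0`,
`B̂(n+1,k) = (n+1-k)(B̂(n,k) + B̂(n,k-2)) + k(B̂(n,k+1) + B̂(n,k-1)) + B̂(n,k+1) + B̂(n,k-2)`;
moreover `B̂(n,0)` equals the number of snakes of length `n`. -/
theorem stmt19 (n : ℕ) (hn : 0 < n) (k : ℤ) (hk : 0 ≤ k) :
    (hatBnk (n + 1) k : ℤ) =
        ((n : ℤ) + 1 - k) * ((hatBnk n k : ℤ) + (hatBnk n (k - 2) : ℤ)) +
          k * ((hatBnk n (k + 1) : ℤ) + (hatBnk n (k - 1) : ℤ)) +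
          (hatBnk n (k + 1) : ℤ) + (hatBnk n (k - 2) : ℤ) ∧
      hatBnk n 0 = snakeCount n :=
  ⟨hatBnk_succ n k, hatBnk_zero_eq_snakeCount hn⟩
end
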